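/- Let i ≥ −1, n ≥ 1 and 0 ≤ r ≤ n+i. Then the map C ↦ Ĉ(r) is a bijection from C_i(n) to the set of C̃ ∈ C_i(n+1) that have an (r+1)⁺-full-set. -/

import Mathlib

/-!
Common definitions for formalizing "A recursion on maximal chains in the Tamari lattices"
(L. Nelson).

* Young diagrams are encoded by their row-length functions `lam : ℕ → ℕ` (rows indexed from 1,
  with `lam 0 = 0`).
* Dyck paths are lists of steps (north/east).
* Tableaux are encoded by entry functions `f : ℕ × ℕ → ℕ` (1-indexed boxes; value `0` means
  "no box").  The label of box `(x, y)` is `f (x, y)`.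
-/

noncomputable section

namespace TamariMaxChains

/-- A step of a lattice path: north or east. -/
inductive Step : Type
  | N : Step
  | E : Step
deriving DecidableEq

/-- Number of north steps of a path. -/
def nCount (p : List Step) : ℕ := p.count Step.N

/-- Number of east steps of a path. -/
def eCount (p : List Step) : ℕ := p.count Step.E

/-- `p` is a Dyck path: equally many norths and easts, and every prefix has at least as many
north steps as east steps (the path never goes below the diagonal `y = x`). -/
def IsDyck (p : List Step) : Prop :=
  nCount p = eCount p ∧ ∀ q : List Step, q <+: p → eCount q ≤ nCount q

/-- `q` is a prime Dyck path: it meets the slope-one line joining its endpoints only at its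
endpoints. -/
def IsPrimeDyck (q : List Step) : Prop :=
  q ≠ [] ∧ nCount q = eCount q ∧
    ∀ s : List Step, s <+: q → s ≠ [] → s ≠ q → eCount s < nCount s

/-- Covering relation of the Tamari lattice on Dyck paths:  `TamariCoverD P' P` means `P'`
covers `P`, i.e. `P'` is obtained from `P` by swapping an east step that is followed by a north
step with the prime Dyck subpath following it. -/
def TamariCoverD (P' P : List Step) : Prop :=
  ∃ a q b : List Step, IsPrimeDyck q ∧
    P = a ++ Step.E :: (q ++ b) ∧ P' = a ++ (q ++ Step.E :: b)

/-- `lam` is the row-length function of a Young diagram: rows are indexed from `1`,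
`lam x` is the number of boxes in row `x`, rows weakly decrease, finitely many boxes. -/
def IsDiagram (lam : ℕ → ℕ) : Prop :=
  lam 0 = 0 ∧ (∀ x, 1 ≤ x → lam (x + 1) ≤ lam x) ∧ ∃ N, ∀ x, N ≤ x → lam x = 0

/-- The height (number of north steps) of the prime path of row `d ≥ 1` of the Young diagram
with row lengths `lam`:  the least `t ≥ 1` such that either `t = d` (row `0` being regarded as
an infinite row of boxes) or row `d - t` has length at least `lam d + t`. -/
def primeHeight (lam : ℕ → ℕ) (d : ℕ) : ℕ :=
  sInf {t | 1 ≤ t ∧ (t = d ∨ (t < d ∧ lam d + t ≤ lam (d - t)))}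

/-- The last box of row `d` is a corner box (last box of its row and lowest box of
its column). -/
def IsCorner (lam : ℕ → ℕ) (d : ℕ) : Prop := 1 ≤ d ∧ 1 ≤ lam d ∧ lam (d + 1) < lam d

/-- The result of removing the `B`-strip of the last box `B` of row `d`: the last box of each of
the rows `d - h + 1, …, d` is removed, where `h` is the height of the prime path of row `d`. -/
def removeStrip (lam : ℕ → ℕ) (d : ℕ) : ℕ → ℕ := fun x =>
  if d + 1 ≤ x + primeHeight lam d ∧ x ≤ d then lam x - 1 else lam x

/-- Covering relation of the Tamari lattice on Young diagrams:  `mu` covers `lam` iff `mu` is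
obtained from `lam` by removing the `B`-strip of a corner box `B`. -/
def TamariCoverY (mu lam : ℕ → ℕ) : Prop := ∃ d, IsCorner lam d ∧ mu = removeStrip lam d

/-- The `B`-strip of the last box `B` of row `d`: the set of last boxes of rows
`d - h + 1, …, d`, where `h` is the height of the prime path of row `d`. -/
def stripSet (lam : ℕ → ℕ) (d : ℕ) : Set (ℕ × ℕ) :=
  {b | b.2 = lam b.1 ∧ 1 ≤ b.2 ∧ d + 1 ≤ b.1 + primeHeight lam d ∧ b.1 ≤ d}

/-- The enclosure of the `B`-strip of the last box `B = (d, lam d)` of row `d`: all boxes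
`(x, y)` with `d - h ≤ x ≤ d` and `lam d ≤ y ≤ lam d + h`, where row `0` is regarded as an
infinite row of boxes. -/
def enclosure (lam : ℕ → ℕ) (d : ℕ) : Set (ℕ × ℕ) :=
  {b | (b.1 = 0 ∨ b.2 ≤ lam b.1) ∧ 1 ≤ b.2 ∧
    d ≤ b.1 + primeHeight lam d ∧ b.1 ≤ d ∧ lam d ≤ b.2 ∧ b.2 ≤ lam d + primeHeight lam d}

/-- The Dyck path of length `2 n` corresponding to the Young diagram `lam` contained in the
staircase `δ_{n-1}` (the Dyck path is the silhouette of the Young diagram). -/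
def toDyck (n : ℕ) (lam : ℕ → ℕ) : List Step :=
  ((List.range n).flatMap fun k =>
    List.replicate (lam (n - k) - lam (n - k + 1)) Step.E ++ [Step.N]) ++
    List.replicate (n - lam 1) Step.E

/-- The prime path of row `d` of the Young diagram `lam`, as its list of steps (read from its
lower-left endpoint). -/
def primePathList (lam : ℕ → ℕ) (d : ℕ) : List Step :=
  Step.N :: ((((List.range (primeHeight lam d - 1)).flatMap fun j =>
    List.replicate (lam (d - 1 - j) - lam (d - j)) Step.E ++ [Step.N])) ++
    List.replicate (lam d + primeHeight lam d - lam (d - (primeHeight lam d - 1))) Step.E)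

/-- `S` translates to `S'` by `p` units down and `q` units to the right. -/
def TranslatesBy (p q : ℤ) (S S' : Set (ℕ × ℕ)) : Prop :=
  ∀ x y : ℕ, (x, y) ∈ S' ↔ ∃ a b : ℕ, (a, b) ∈ S ∧ (x : ℤ) = a + p ∧ (y : ℤ) = b + q

/-- `S` translates to `S'`. -/
def Translates (S S' : Set (ℕ × ℕ)) : Prop := ∃ p q : ℤ, TranslatesBy p q S S'

/-- The length of a tableau: its number of distinct labels (for an honest tableau, labels are
exactly `1, …, tlen f`). -/
def tlen (f : ℕ × ℕ → ℕ) : ℕ := sSup {v | v ≠ 0 ∧ ∃ b, f b = v}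

/-- The number of boxes in row `x` of a tableau. -/
def rowLen (f : ℕ × ℕ → ℕ) (x : ℕ) : ℕ := sSup {y | f (x, y) ≠ 0}

/-- The number of boxes in column `y` of a tableau. -/
def colLen (f : ℕ × ℕ → ℕ) (y : ℕ) : ℕ := sSup {x | f (x, y) ≠ 0}

/-- `f` is (the entry function of) a tableau: the support is a Young diagram (1-indexed),
rows strictly increase, columns weakly increase, and the set of labels is exactly
`{1, …, tlen f}`. -/
def IsTableau (f : ℕ × ℕ → ℕ) : Prop :=
  (∀ y, f (0, y) = 0) ∧ (∀ x, f (x, 0) = 0) ∧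
  {b : ℕ × ℕ | f b ≠ 0}.Finite ∧
  (∀ x y x' y', 1 ≤ x' → x' ≤ x → 1 ≤ y' → y' ≤ y → f (x, y) ≠ 0 → f (x', y') ≠ 0) ∧
  (∀ x y, f (x, y) ≠ 0 → f (x, y + 1) ≠ 0 → f (x, y) < f (x, y + 1)) ∧
  (∀ x y, f (x, y) ≠ 0 → f (x + 1, y) ≠ 0 → f (x, y) ≤ f (x + 1, y)) ∧
  (∀ v, 1 ≤ v → (v ≤ tlen f ↔ ∃ b, f b = v))

/-- `T^(r)`: the subtableau of all entries at most `r`. -/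
def trunc (f : ℕ × ℕ → ℕ) (r : ℕ) : ℕ × ℕ → ℕ := fun b => if f b ≤ r then f b else 0

/-- The shape (row-length function) of a tableau. -/
def shapeOf (f : ℕ × ℕ → ℕ) : ℕ → ℕ := fun x => rowLen f x

/-- The row index of the end-box of the `k`-set of `f` (the maximal row index of a box
labeled `k`). -/
def endRow (f : ℕ × ℕ → ℕ) (k : ℕ) : ℕ := sSup {x | ∃ y, f (x, y) = k}

/-- `Y 0 ⋗ Y 1 ⋗ ⋯ ⋗ Y l` is a saturated chain in the Tamari order on Young diagrams whose
maximal element `Y 0` is the empty diagram (each `Y r` covers `Y (r+1)`). -/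
def IsTamariChain (Y : ℕ → ℕ → ℕ) (l : ℕ) : Prop :=
  (∀ r, r ≤ l → IsDiagram (Y r)) ∧ (∀ x, Y 0 x = 0) ∧
    ∀ r, r < l → TamariCoverY (Y r) (Y (r + 1))

/-- The tableau `ψ(C)` of the saturated chain `C = (∅ = Y 0 ⋗ ⋯ ⋗ Y l)`: the boxes removed in
the transition `Y (r-1) ⋗ Y r` are labeled `r`; that is, each box of `Y l` is labeled by the
least `r` such that the box belongs to `Y r`. -/
def psiFun (Y : ℕ → ℕ → ℕ) (l : ℕ) : ℕ × ℕ → ℕ := fun b =>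
  if 1 ≤ b.1 ∧ 1 ≤ b.2 ∧ b.2 ≤ Y l b.1 then sInf {r | r ≤ l ∧ b.2 ≤ Y r b.1} else 0

/-- `f` is a `ψ`-tableau: it is in the image of `ψ`. -/
def IsPsiTab (f : ℕ × ℕ → ℕ) : Prop :=
  ∃ l Y, IsTamariChain Y l ∧ f = psiFun Y l

/-- Row lengths of the staircase shape `δ_{n-1} = (n-1, n-2, …, 1)`: row `x ≥ 1` has `n - x`
boxes. -/
def dstair (n : ℕ) : ℕ → ℕ := fun x => if x = 0 then 0 else n - x

/-- `C_i(n)`, via `ψ`: the set of maximal chains of length `n + i` in the Tamari lattice `T_n`,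
identified with the `ψ`-tableaux of length `n + i` and shape `δ_{n-1}`. -/
def MemC (i : ℤ) (n : ℕ) (f : ℕ × ℕ → ℕ) : Prop :=
  IsTableau f ∧ IsPsiTab f ∧ (∀ x, rowLen f x = dstair n x) ∧ (tlen f : ℤ) = (n : ℤ) + i

/-- The `r`-set of `f` (of shape `δ_{n-1}`) is a full-set with end-box `(k, n - k)`:
it begins in row `1` and ends in the outer diagonal, at the box `(k, n - k)`. -/
def HasFullSetAt (f : ℕ × ℕ → ℕ) (n r k : ℕ) : Prop :=
  (∃ y, f (1, y) = r) ∧ 1 ≤ k ∧ k ≤ n - 1 ∧ f (k, n - k) = r ∧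
    ∀ x y, f (x, y) = r → x ≤ k

/-- `f` has an `r`-full-set. -/
def HasFullSet (f : ℕ × ℕ → ℕ) (n r : ℕ) : Prop := ∃ k, HasFullSetAt f n r k

/-- `f` has an `r⁺`-full-set (plus-full-set): an `r`-full-set whose end-box `(k, n-k)` satisfies
`k = n - 1`, or `k ≤ n - 2` and the southwest neighbor has a smaller label. -/
def HasPlusFullSet (f : ℕ × ℕ → ℕ) (n r : ℕ) : Prop :=
  ∃ k, HasFullSetAt f n r k ∧ (k = n - 1 ∨ (k ≤ n - 2 ∧ f (k + 1, n - k - 1) < r))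

/-- `F_i^r(n)`: the set of `C ∈ C_i(n)` whose `r`-set is a plus-full-set and whose `j`-set is
not a plus-full-set for any `j ∈ [r-1]`. -/
def MemF (i : ℤ) (n : ℕ) (r : ℕ) (f : ℕ × ℕ → ℕ) : Prop :=
  MemC i n f ∧ HasPlusFullSet f n r ∧ ∀ j, 1 ≤ j → j < r → ¬ HasPlusFullSet f n j

/-- `N_i(n)`: the set of `C ∈ C_i(n)` having no plus-full-sets. -/
def MemN (i : ℤ) (n : ℕ) (f : ℕ × ℕ → ℕ) : Prop :=
  MemC i n f ∧ ∀ r, ¬ HasPlusFullSet f n r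

/-- `α_d`: shift all rows of index greater than `d` down one row and repeat row `d` in
row `d + 1`. -/
def alphaFun (d : ℕ) (f : ℕ × ℕ → ℕ) : ℕ × ℕ → ℕ := fun b =>
  if b.1 ≤ d then f b else f (b.1 - 1, b.2)

/-- `β_d`: append a box labeled `tlen f + 1` at the end of each of the rows `1, …, d`. -/
def betaFun (d : ℕ) (f : ℕ × ℕ → ℕ) : ℕ × ℕ → ℕ := fun b =>
  if 1 ≤ b.1 ∧ b.1 ≤ d ∧ b.2 = rowLen f b.1 + 1 then tlen f + 1 else f b

/-- The number of boxes of row `x` of `f` whose label is at most `r` (these occupy an initial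
segment of the row). -/
def lowLen (f : ℕ × ℕ → ℕ) (r x : ℕ) : ℕ := sSup {y | f (x, y) ≠ 0 ∧ f (x, y) ≤ r}

/-- The row index `d` used in the definition of `Ĉ(r)`: the minimal `k ∈ [n-1]` with
`C (k, n-k) ≤ r` if such `k` exists, and `n` otherwise. -/
def hatD (f : ℕ × ℕ → ℕ) (n r : ℕ) : ℕ :=
  sInf ({k | 1 ≤ k ∧ k ≤ n - 1 ∧ 1 ≤ f (k, n - k) ∧ f (k, n - k) ≤ r} ∪ {n})

/-- `Ĉ(r)` for `C ∈ C_i(n)` and `0 ≤ r ≤ n + i`: starting from `β_d(α_d(C^(r)))` (where `d` is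
as in `hatD`), the entries of `C` greater than `r` of row index less than `d` are translated one
unit to the right, those of row index greater than `d` are translated one unit down, and all
these labels are incremented by one. -/
def hatFun (f : ℕ × ℕ → ℕ) (n r : ℕ) : ℕ × ℕ → ℕ := fun b =>
  let d := hatD f n r
  let x := b.1
  let y := b.2
  if x = 0 ∨ y = 0 then 0
  else if x ≤ d then
    if f (x, y) ≠ 0 ∧ f (x, y) ≤ r then f (x, y)
    else if y = lowLen f r x + 1 then r + 1
    else if r < f (x, y - 1) then f (x, y - 1) + 1
    else 0
  else if x = d + 1 then f (d, y)
  else if f (x - 1, y) = 0 then 0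
  else if f (x - 1, y) ≤ r then f (x - 1, y)
  else f (x - 1, y) + 1

/-- `RepBy i m t r C0 C` : `C = (φ_{i,m+t-1}^{r 1} ∘ φ_{i,m+t-2}^{r 2} ∘ ⋯ ∘ φ_{i,m}^{r t}) C0`,
each factor being applied within its domain. -/
def RepBy (i : ℤ) (m t : ℕ) (r : ℕ → ℕ) (C0 C : ℕ × ℕ → ℕ) : Prop :=
  ∃ D : ℕ → ℕ × ℕ → ℕ, D 0 = C0 ∧ D t = C ∧
    ∀ s, s < t →
      MemC i (m + s) (D s) ∧
      ((r (t - s) : ℤ) ≤ (m : ℤ) + s + i) ∧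
      (∀ j, 1 ≤ j → j ≤ r (t - s) → ¬ HasPlusFullSet (D s) (m + s) j) ∧
      D (s + 1) = hatFun (D s) (m + s) (r (t - s))

/-- The set `𝕏_{d,n-1}^r` of Theorem 4.3: `ψ`-tableaux of length `r`, contained in `δ_{n-1}`,
whose row `d` has length `n - d` and whose prime path of row `d` has height `d`. -/
def MemX (d n r : ℕ) (f : ℕ × ℕ → ℕ) : Prop :=
  IsTableau f ∧ IsPsiTab f ∧ tlen f = r ∧
    (∀ x, 1 ≤ x → rowLen f x ≤ n - x) ∧
    rowLen f d = n - d ∧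
    primeHeight (shapeOf f) d = d

/-- The set `ℤ_{d,n}^{r+1}` of Theorem 4.3: `ψ`-tableaux of length `r + 1`, contained in `δ_n`,
such that rows `d` and `d+1` of the truncation at `r` are identical, the end-box of the
`(r+1)`-set is `(d, n-d+1)`, and the prime path of `(d, n-d+1)` has height `d`. -/
def MemZ (d n r : ℕ) (g : ℕ × ℕ → ℕ) : Prop :=
  IsTableau g ∧ IsPsiTab g ∧ tlen g = r + 1 ∧
    (∀ x, 1 ≤ x → rowLen g x ≤ n + 1 - x) ∧
    (∀ y, trunc g r (d, y) = trunc g r (d + 1, y)) ∧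
    g (d, n - d + 1) = r + 1 ∧ (∀ x y, g (x, y) = r + 1 → x ≤ d) ∧
    primeHeight (shapeOf g) d = d

/-- Relational form of the covering relation: strip in rows `b, …, e`. -/
structure Cov (mu lam : ℕ → ℕ) (b e : ℕ) : Prop where
  hb : 1 ≤ b
  hbe : b ≤ e
  corner : lam (e + 1) < lam e
  top : b = 1 ∨ lam e + e + 1 ≤ lam (b - 1) + b
  mid : ∀ x, b ≤ x → x < e → lam x + x < lam e + e
  eqIn : ∀ x, b ≤ x → x ≤ e → lam x = mu x + 1
  eqOut : ∀ x, x < b ∨ e < x → lam x = mu x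

lemma diag_anti {lam : ℕ → ℕ} (h : IsDiagram lam) {x y : ℕ} (hx : 1 ≤ x) (hxy : x ≤ y) :
    lam y ≤ lam x := by
  induction y, hxy using Nat.le_induction with
  | base => exact le_rfl
  | succ k hk ih => exact (h.2.1 k (by omega)).trans ih

lemma primeHeight_eq {lam : ℕ → ℕ} {b e : ℕ} (hb : 1 ≤ b) (hbe : b ≤ e)
    (top : b = 1 ∨ lam e + e + 1 ≤ lam (b - 1) + b)
    (mid : ∀ x, b ≤ x → x < e → lam x + x < lam e + e) :
    primeHeight lam e = e + 1 - b := by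
  unfold primeHeight
  have hmem : e + 1 - b ∈ {t | 1 ≤ t ∧ (t = e ∨ (t < e ∧ lam e + t ≤ lam (e - t)))} := by
    refine ⟨by omega, ?_⟩
    rcases eq_or_ne b 1 with h | h
    · left; omega
    · right
      have : e - (e + 1 - b) = b - 1 := by omega
      rw [this]
      omega
  apply le_antisymm (Nat.sInf_le hmem)
  obtain ⟨h1, h2⟩ := Nat.sInf_mem ⟨_, hmem⟩
  set t := sInf {t | 1 ≤ t ∧ (t = e ∨ (t < e ∧ lam e + t ≤ lam (e - t)))} with ht
  by_contra hlt
  rcases h2 with h2 | ⟨h2, h3⟩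
  · omega
  · have := mid (e - t) (by omega) (by omega)
    omega

lemma cov_to {mu lam : ℕ → ℕ} {b e : ℕ} (h : Cov mu lam b e) : TamariCoverY mu lam := by
  have hp := primeHeight_eq h.hb h.hbe h.top h.mid
  have h1 := h.hb
  have h2 := h.hbe
  have h3 := h.corner
  refine ⟨e, ⟨by omega, by omega, h3⟩, ?_⟩
  funext x
  unfold removeStrip
  rw [hp]
  split_ifs with hx
  · have := h.eqIn x (by omega) (by omega); omega
  · have := h.eqOut x (by omega); omega

lemma cov_of {mu lam : ℕ → ℕ} (hl : IsDiagram lam) (h : TamariCoverY mu lam) :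
    ∃ b e, Cov mu lam b e := by
  obtain ⟨e, ⟨he, hle, hc⟩, rfl⟩ := h
  have hmem : e ∈ {t | 1 ≤ t ∧ (t = e ∨ (t < e ∧ lam e + t ≤ lam (e - t)))} :=
    ⟨he, Or.inl rfl⟩
  have hs := Nat.sInf_mem ⟨_, hmem⟩
  have hle' : primeHeight lam e ≤ e := Nat.sInf_le hmem
  have hmin : ∀ t, 1 ≤ t → t < primeHeight lam e → ¬ (lam e + t ≤ lam (e - t)) := by
    intro t ht1 ht2 ht3
    exact Nat.notMem_of_lt_sInf ht2 ⟨ht1, Or.inr ⟨by omega, ht3⟩⟩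
  change 1 ≤ primeHeight lam e ∧ (primeHeight lam e = e ∨
    (primeHeight lam e < e ∧ lam e + primeHeight lam e ≤ lam (e - primeHeight lam e))) at hs
  obtain ⟨hs1, hs2⟩ := hs
  refine ⟨e + 1 - primeHeight lam e, e, by omega, by omega, hc, ?_, ?_, ?_, ?_⟩
  · rcases hs2 with h | ⟨h, h'⟩
    · left; omega
    · right
      have : e + 1 - primeHeight lam e - 1 = e - primeHeight lam e := by omega
      rw [this]; omega
  · intro x h1 h2
    have := hmin (e - x) (by omega) (by omega)
    have h3 : e - (e - x) = x := by omega
    rw [h3] at this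
    omega
  · intro x h1 h2
    have := diag_anti hl (x := x) (y := e) (by omega) h2
    unfold removeStrip
    rw [if_pos (by omega)]
    omega
  · intro x h1
    unfold removeStrip
    rw [if_neg (by omega)]

section chain
variable {Y : ℕ → ℕ → ℕ} {l : ℕ}

lemma chain_cov (hY : IsTamariChain Y l) {s : ℕ} (hs : s < l) :
    ∃ b e, Cov (Y s) (Y (s + 1)) b e :=
  cov_of (hY.1 _ (by omega)) (hY.2.2 s hs)

lemma chain_step (hY : IsTamariChain Y l) {s : ℕ} (hs : s < l) (x : ℕ) :
    Y s x ≤ Y (s + 1) x ∧ Y (s + 1) x ≤ Y s x + 1 := by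
  obtain ⟨b, e, h⟩ := chain_cov hY hs
  by_cases hx : b ≤ x ∧ x ≤ e
  · have := h.eqIn x hx.1 hx.2; omega
  · have := h.eqOut x (by omega); omega

lemma chain_mono (hY : IsTamariChain Y l) {s t : ℕ} (hst : s ≤ t) (ht : t ≤ l) (x : ℕ) :
    Y s x ≤ Y t x := by
  induction t, hst using Nat.le_induction with
  | base => exact le_rfl
  | succ k hk ih => exact (ih (by omega)).trans (chain_step hY (by omega) x).1

lemma psi_zero {x y : ℕ} (h : ¬ (1 ≤ x ∧ 1 ≤ y ∧ y ≤ Y l x)) : psiFun Y l (x, y) = 0 := by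
  unfold psiFun; rw [if_neg h]

lemma psi_spec (hY : IsTamariChain Y l) {x y : ℕ} (h : 1 ≤ x ∧ 1 ≤ y ∧ y ≤ Y l x) :
    1 ≤ psiFun Y l (x, y) ∧ psiFun Y l (x, y) ≤ l ∧
    ∀ s, s ≤ l → (psiFun Y l (x, y) ≤ s ↔ y ≤ Y s x) := by
  have hv : psiFun Y l (x, y) = sInf {r | r ≤ l ∧ y ≤ Y r x} := by
    unfold psiFun; rw [if_pos h]
  rw [hv]
  have hm : l ∈ {r | r ≤ l ∧ y ≤ Y r x} := ⟨le_rfl, h.2.2⟩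
  obtain ⟨h1, h2⟩ := Nat.sInf_mem ⟨_, hm⟩
  refine ⟨?_, h1, fun s hs => ⟨fun h' => h2.trans (chain_mono hY h' hs x), fun h' =>
    Nat.sInf_le ⟨hs, h'⟩⟩⟩
  by_contra h0
  have h0 : sInf {r | r ≤ l ∧ y ≤ Y r x} = 0 := by omega
  rw [h0, hY.2.1 x] at h2
  omega

lemma psi_le (hY : IsTamariChain Y l) {x y s : ℕ} (hs : s ≤ l) (hx : 1 ≤ x) :
    (psiFun Y l (x, y) ≠ 0 ∧ psiFun Y l (x, y) ≤ s) ↔ (1 ≤ y ∧ y ≤ Y s x) := by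
  by_cases h : 1 ≤ x ∧ 1 ≤ y ∧ y ≤ Y l x
  · obtain ⟨h1, h2, h3⟩ := psi_spec hY h
    have := h3 s hs
    omega
  · rw [psi_zero h]
    have := chain_mono hY hs le_rfl x
    omega

lemma psi_ne (hY : IsTamariChain Y l) {x y : ℕ} :
    psiFun Y l (x, y) ≠ 0 ↔ (1 ≤ x ∧ 1 ≤ y ∧ y ≤ Y l x) := by
  by_cases h : 1 ≤ x ∧ 1 ≤ y ∧ y ≤ Y l x
  · obtain ⟨h1, h2, h3⟩ := psi_spec hY h
    exact ⟨fun _ => h, fun _ => by omega⟩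
  · rw [psi_zero h]; simp [h]

lemma psi_eq (hY : IsTamariChain Y l) {x y v : ℕ} (hv : v < l) (hx : 1 ≤ x) :
    psiFun Y l (x, y) = v + 1 ↔ (Y v x < y ∧ y ≤ Y (v + 1) x) := by
  have h1 := psi_le hY (x := x) (y := y) (s := v) (by omega) hx
  have h2 := psi_le hY (x := x) (y := y) (s := v + 1) (by omega) hx
  omega

lemma sSup_Icc_nat {S : Set ℕ} {m : ℕ} (h : ∀ y, y ∈ S ↔ (1 ≤ y ∧ y ≤ m)) : sSup S = m := by
  rcases Nat.eq_zero_or_pos m with h0 | h0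
  · have : S = ∅ := by
      ext y; rw [h]; simp; omega
    rw [this]; simp [h0]
  · exact IsGreatest.csSup_eq ⟨(h m).2 ⟨h0, le_rfl⟩, fun y hy => ((h y).1 hy).2⟩

lemma psi_lowLen (hY : IsTamariChain Y l) {x s : ℕ} (hs : s ≤ l) (hx : 1 ≤ x) :
    lowLen (psiFun Y l) s x = Y s x :=
  sSup_Icc_nat fun _ => psi_le hY hs hx

lemma psi_rowLen (hY : IsTamariChain Y l) (x : ℕ) : rowLen (psiFun Y l) x = Y l x := by
  apply sSup_Icc_nat
  intro y
  change psiFun Y l (x, y) ≠ 0 ↔ _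
  rw [psi_ne hY]
  rcases Nat.eq_zero_or_pos x with h | h
  · subst h
    have := (hY.1 l le_rfl).1
    omega
  · omega

lemma psi_surj (hY : IsTamariChain Y l) (v : ℕ) :
    (v ≠ 0 ∧ ∃ b, psiFun Y l b = v) ↔ (1 ≤ v ∧ v ≤ l) := by
  constructor
  · rintro ⟨h0, ⟨x, y⟩, h⟩
    have h1 := (psi_ne hY (x := x) (y := y)).1 (by omega)
    have := psi_spec hY h1
    omega
  · rintro ⟨h1, h2⟩
    refine ⟨by omega, ?_⟩
    obtain ⟨w, rfl⟩ : ∃ w, v = w + 1 := ⟨v - 1, by omega⟩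
    obtain ⟨b, e, h⟩ := chain_cov hY (s := w) (by omega)
    refine ⟨(e, Y (w + 1) e), ?_⟩
    have hb := h.hb
    have hbe := h.hbe
    rw [psi_eq hY (by omega) (by omega)]
    have := h.eqIn e hbe le_rfl
    omega

lemma psi_tlen (hY : IsTamariChain Y l) : tlen (psiFun Y l) = l :=
  sSup_Icc_nat fun v => psi_surj hY v

lemma psi_tab (hY : IsTamariChain Y l) : IsTableau (psiFun Y l) := by
  have hD := hY.1 l le_rfl
  refine ⟨fun y => psi_zero (by omega), fun x => psi_zero (by omega), ?_, ?_, ?_, ?_, ?_⟩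
  · obtain ⟨N, hN⟩ := hD.2.2
    apply (Set.finite_Iic ((N, Y l 1) : ℕ × ℕ)).subset
    rintro ⟨x, y⟩ h
    have h := (psi_ne hY).1 h
    refine ⟨?_, ?_⟩
    · by_contra hc
      have := hN x (by simp at hc; omega)
      omega
    · have := diag_anti hD (le_refl 1) h.1
      simp; omega
  · intro x y x' y' h1 h2 h3 h4 h5
    rw [psi_ne hY] at h5 ⊢
    have := diag_anti hD h1 h2
    omega
  · intro x y h1 h2
    rw [psi_ne hY] at h1 h2
    obtain ⟨a1, a2, a3⟩ := psi_spec hY h1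
    obtain ⟨b1, b2, b3⟩ := psi_spec hY h2
    obtain ⟨w, hw⟩ : ∃ w, psiFun Y l (x, y + 1) = w + 1 := ⟨_, (Nat.sub_add_cancel b1).symm⟩
    have := (psi_eq hY (by omega) h1.1).1 hw
    have hs := chain_step hY (s := w) (by omega) x
    have := (a3 w (by omega)).2 (by omega)
    omega
  · intro x y h1 h2
    rw [psi_ne hY] at h1 h2
    obtain ⟨a1, a2, a3⟩ := psi_spec hY h1
    obtain ⟨b1, b2, b3⟩ := psi_spec hY h2
    rw [a3 _ b2]
    have := (b3 _ b2).1 le_rfl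
    have := (hY.1 _ b2).2.1 x h1.1
    omega
  · intro v hv
    rw [psi_tlen hY]
    have := psi_surj hY v
    constructor
    · intro h; exact (this.2 ⟨hv, h⟩).2
    · intro h; exact (this.1 ⟨by omega, h⟩).2

end chain

lemma memC_iff {i : ℤ} {n : ℕ} {f : ℕ × ℕ → ℕ} : MemC i n f ↔
    ∃ l Y, IsTamariChain Y l ∧ f = psiFun Y l ∧ (∀ x, Y l x = dstair n x) ∧
      (l : ℤ) = (n : ℤ) + i := by
  constructor
  · rintro ⟨h1, ⟨l, Y, hY, rfl⟩, h3, h4⟩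
    refine ⟨l, Y, hY, rfl, fun x => ?_, ?_⟩
    · rw [← h3, psi_rowLen hY]
    · rw [← h4, psi_tlen hY]
  · rintro ⟨l, Y, hY, rfl, h1, h2⟩
    refine ⟨psi_tab hY, ⟨l, Y, hY, rfl⟩, fun x => ?_, ?_⟩
    · rw [psi_rowLen hY, h1]
    · rw [psi_tlen hY, h2]

/-- No row above row `d` blocks it (the prime path of row `d` has height `d`). -/
def NB (lam : ℕ → ℕ) (d : ℕ) : Prop := ∀ x, 1 ≤ x → x < d → lam x + x < lam d + d

lemma Cov.start_one {mu lam : ℕ → ℕ} {b e d : ℕ} (h : Cov mu lam b e) (hn : NB lam d)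
    (h1 : b ≤ d) (h2 : d ≤ e) : b = 1 := by
  by_contra hb
  have hb1 := h.hb
  have ht := h.top
  have := hn (b - 1) (by omega) (by omega)
  rcases eq_or_lt_of_le h2 with rfl | h3
  · omega
  · have := h.mid d h1 h3
    omega

lemma Cov.nb {mu lam : ℕ → ℕ} {b e d : ℕ} (h : Cov mu lam b e) (hn : NB lam d) : NB mu d := by
  intro x hx hxd
  have h0 := hn x hx hxd
  have hle : mu x ≤ lam x := by
    by_cases hx : b ≤ x ∧ x ≤ e
    · have := h.eqIn x hx.1 hx.2; omega
    · have := h.eqOut x (by omega); omega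
  by_cases hd : b ≤ d ∧ d ≤ e
  · have := h.start_one hn hd.1 hd.2
    have h1 := h.eqIn d hd.1 hd.2
    have h2 := h.eqIn x (by omega) (by omega)
    omega
  · have := h.eqOut d (by omega); omega

lemma chain_nb {Y : ℕ → ℕ → ℕ} {l d s t : ℕ} (hY : IsTamariChain Y l) (ht : t ≤ l)
    (hst : s ≤ t) (h : NB (Y t) d) : NB (Y s) d := by
  induction t, hst using Nat.le_induction with
  | base => exact h
  | succ k hk ih =>
    obtain ⟨b, e, hc⟩ := chain_cov hY (s := k) (by omega)
    exact ih (by omega) (hc.nb h)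

/-- duplicate row `d` -/
def al (d : ℕ) (lam : ℕ → ℕ) (x : ℕ) : ℕ := if x ≤ d then lam x else lam (x - 1)

/-- duplicate row `d`, then append a box to rows `1, …, d` -/
def be (d : ℕ) (lam : ℕ → ℕ) (x : ℕ) : ℕ :=
  if x = 0 then 0 else if x ≤ d then lam x + 1 else lam (x - 1)

lemma al_le {d x : ℕ} (lam : ℕ → ℕ) (h : x ≤ d) : al d lam x = lam x := if_pos h
lemma al_gt {d x : ℕ} (lam : ℕ → ℕ) (h : d < x) : al d lam x = lam (x - 1) := if_neg (by omega)
lemma be_le {d x : ℕ} (lam : ℕ → ℕ) (h0 : 1 ≤ x) (h : x ≤ d) : be d lam x = lam x + 1 := by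
  unfold be; rw [if_neg (by omega), if_pos h]
lemma be_gt {d x : ℕ} (lam : ℕ → ℕ) (h : d < x) : be d lam x = lam (x - 1) := by
  unfold be; rw [if_neg (by omega), if_neg (by omega)]

lemma al_diag {d : ℕ} {lam : ℕ → ℕ} (hd : 1 ≤ d) (h : IsDiagram lam) : IsDiagram (al d lam) := by
  refine ⟨by rw [al_le _ (by omega), h.1], ?_, ?_⟩
  · intro x hx
    rcases lt_trichotomy x d with h1 | h1 | h1
    · rw [al_le _ (by omega), al_le _ (by omega)]; exact h.2.1 x hx
    · rw [al_gt _ (by omega), al_le _ (by omega)]; simp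
    · rw [al_gt _ (by omega), al_gt _ (by omega)]; exact diag_anti h (by omega) (by omega)
  · obtain ⟨N, hN⟩ := h.2.2
    refine ⟨N + d + 1, fun x hx => ?_⟩
    rw [al_gt _ (by omega)]; exact hN _ (by omega)

lemma be_diag {d : ℕ} {lam : ℕ → ℕ} (hd : 1 ≤ d) (h : IsDiagram lam) : IsDiagram (be d lam) := by
  refine ⟨by simp [be], ?_, ?_⟩
  · intro x hx
    rcases lt_trichotomy x d with h1 | h1 | h1
    · rw [be_le _ (by omega) (by omega), be_le _ (by omega) (by omega)]
      have := h.2.1 x hx; omega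
    · rw [be_gt _ (by omega), be_le _ (by omega) (by omega)]; simp
    · rw [be_gt _ (by omega), be_gt _ (by omega)]; exact diag_anti h (by omega) (by omega)
  · obtain ⟨N, hN⟩ := h.2.2
    refine ⟨N + d + 1, fun x hx => ?_⟩
    rw [be_gt _ (by omega)]; exact hN _ (by omega)

lemma al_cov {d : ℕ} {mu lam : ℕ → ℕ} {b e : ℕ} (hd : 1 ≤ d) (hn : NB lam d)
    (h : Cov mu lam b e) : ∃ b' e', Cov (al d mu) (al d lam) b' e' := by
  obtain ⟨hb, hbe, hc, ht, hm, hi, ho⟩ := id h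
  by_cases hed : e < d
  · refine ⟨b, e, hb, hbe, ?_, ?_, ?_, ?_, ?_⟩
    · rwa [al_le _ (by omega), al_le _ (by omega)]
    · rwa [al_le _ (by omega), al_le _ (by omega)]
    · intro x h1 h2
      rw [al_le _ (by omega), al_le _ (by omega)]; exact hm x h1 h2
    · intro x h1 h2
      rw [al_le _ (by omega), al_le _ (by omega)]; exact hi x h1 h2
    · intro x h1
      by_cases hx : x ≤ d
      · rw [al_le _ hx, al_le _ hx]; exact ho x h1
      · rw [al_gt _ (by omega), al_gt _ (by omega)]; exact ho _ (by omega)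
  · by_cases hbd : b ≤ d
    · have hb1 := h.start_one hn hbd (by omega)
      subst hb1
      refine ⟨1, e + 1, le_rfl, by omega, ?_, Or.inl rfl, ?_, ?_, ?_⟩
      · rw [al_gt _ (by omega), al_gt _ (by omega)]; exact hc
      · intro x h1 h2
        rw [al_gt (x := e + 1) _ (by omega)]
        simp only [Nat.add_sub_cancel]
        by_cases hx : x ≤ d
        · rw [al_le _ hx]
          rcases eq_or_lt_of_le (show x ≤ e by omega) with rfl | h3
          · omega
          · have := hm x h1 h3; omega
        · rw [al_gt _ (by omega)]
          have := hm (x - 1) (by omega) (by omega); omega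
      · intro x h1 h2
        by_cases hx : x ≤ d
        · rw [al_le _ hx, al_le _ hx]; exact hi x h1 (by omega)
        · rw [al_gt _ (by omega), al_gt _ (by omega)]; exact hi _ (by omega) (by omega)
      · intro x h1
        by_cases hx : x ≤ d
        · rw [al_le _ hx, al_le _ hx]; exact ho x (by omega)
        · rw [al_gt _ (by omega), al_gt _ (by omega)]; exact ho _ (by omega)
    · refine ⟨b + 1, e + 1, by omega, by omega, ?_, ?_, ?_, ?_, ?_⟩
      · rw [al_gt _ (by omega), al_gt _ (by omega)]; exact hc
      · rw [al_gt _ (by omega), al_gt _ (by omega)]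
        simp only [Nat.add_sub_cancel]; omega
      · intro x h1 h2
        rw [al_gt _ (by omega), al_gt _ (by omega)]
        simp only [Nat.add_sub_cancel]
        have := hm (x - 1) (by omega) (by omega); omega
      · intro x h1 h2
        rw [al_gt _ (by omega), al_gt _ (by omega)]; exact hi _ (by omega) (by omega)
      · intro x h1
        by_cases hx : x ≤ d
        · rw [al_le _ hx, al_le _ hx]; exact ho x (by omega)
        · rw [al_gt _ (by omega), al_gt _ (by omega)]; exact ho _ (by omega)

lemma be_cov {d : ℕ} {mu lam : ℕ → ℕ} {b e : ℕ} (hd : 1 ≤ d) (hfix : lam d = mu d)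
    (h : Cov mu lam b e) : ∃ b' e', Cov (be d mu) (be d lam) b' e' := by
  obtain ⟨hb, hbe, hc, ht, hm, hi, ho⟩ := id h
  have hnot : ¬ (b ≤ d ∧ d ≤ e) := fun hh => by
    have := hi d hh.1 hh.2; omega
  by_cases hed : e < d
  · refine ⟨b, e, hb, hbe, ?_, ?_, ?_, ?_, ?_⟩
    · rw [be_le _ (by omega) (by omega), be_le _ (by omega) (by omega)]; omega
    · rcases eq_or_ne b 1 with h1 | h1
      · exact Or.inl h1
      · rw [be_le _ (by omega) (by omega), be_le _ (by omega) (by omega)]; omega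
    · intro x h1 h2
      rw [be_le _ (by omega) (by omega), be_le _ (by omega) (by omega)]
      have := hm x h1 h2; omega
    · intro x h1 h2
      rw [be_le _ (by omega) (by omega), be_le _ (by omega) (by omega)]
      have := hi x h1 h2; omega
    · intro x h1
      rcases Nat.eq_zero_or_pos x with h0 | h0
      · subst h0; simp [be]
      by_cases hx : x ≤ d
      · rw [be_le _ h0 hx, be_le _ h0 hx, ho x h1]
      · rw [be_gt _ (by omega), be_gt _ (by omega)]; exact ho _ (by omega)
  · refine ⟨b + 1, e + 1, by omega, by omega, ?_, ?_, ?_, ?_, ?_⟩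
    · rw [be_gt _ (by omega), be_gt _ (by omega)]; exact hc
    · right
      rw [be_gt _ (by omega)]
      simp only [Nat.add_sub_cancel]
      rw [be_gt _ (by omega)]
      omega
    · intro x h1 h2
      rw [be_gt _ (by omega), be_gt _ (by omega)]
      simp only [Nat.add_sub_cancel]
      have := hm (x - 1) (by omega) (by omega); omega
    · intro x h1 h2
      rw [be_gt _ (by omega), be_gt _ (by omega)]; exact hi _ (by omega) (by omega)
    · intro x h1
      rcases Nat.eq_zero_or_pos x with h0 | h0
      · subst h0; simp [be]
      by_cases hx : x ≤ d
      · rw [be_le _ h0 hx, be_le _ h0 hx, ho x (by omega)]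
      · rw [be_gt _ (by omega), be_gt _ (by omega)]; exact ho _ (by omega)

lemma mid_cov {d : ℕ} {lam : ℕ → ℕ} (hd : 1 ≤ d) (h0 : lam 0 = 0) (hn : NB lam d) :
    Cov (al d lam) (be d lam) 1 d := by
  refine ⟨le_rfl, hd, ?_, Or.inl rfl, ?_, ?_, ?_⟩
  · rw [be_gt _ (by omega), be_le _ (by omega) (by omega)]; simp
  · intro x h1 h2
    rw [be_le _ (by omega) (by omega), be_le _ (by omega) (by omega)]
    have := hn x h1 h2; omega
  · intro x h1 h2
    rw [be_le _ (by omega) (by omega), al_le _ h2]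
  · intro x h1
    rcases Nat.eq_zero_or_pos x with h2 | h2
    · subst h2; simp [be, al, h0]
    · rw [be_gt _ (by omega), al_gt _ (by omega)]

/-- the chain of `Ĉ(r)` -/
def hatCh (d r : ℕ) (Y : ℕ → ℕ → ℕ) (s : ℕ) : ℕ → ℕ :=
  if s ≤ r then al d (Y s) else be d (Y (s - 1))

lemma hatCh_le {d r s : ℕ} (Y : ℕ → ℕ → ℕ) (h : s ≤ r) : hatCh d r Y s = al d (Y s) := if_pos h
lemma hatCh_gt {d r s : ℕ} (Y : ℕ → ℕ → ℕ) (h : r < s) :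
    hatCh d r Y s = be d (Y (s - 1)) := if_neg (by omega)

lemma hat_chain {Y : ℕ → ℕ → ℕ} {l d r : ℕ} (hY : IsTamariChain Y l) (hr : r ≤ l) (hd : 1 ≤ d)
    (hn : NB (Y r) d) (hfix : ∀ s, r ≤ s → s ≤ l → Y s d = Y r d) :
    IsTamariChain (hatCh d r Y) (l + 1) := by
  refine ⟨?_, ?_, ?_⟩
  · intro s hs
    by_cases h : s ≤ r
    · rw [hatCh_le _ h]; exact al_diag hd (hY.1 s (by omega))
    · rw [hatCh_gt _ (by omega)]; exact be_diag hd (hY.1 _ (by omega))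
  · intro x
    rw [hatCh_le _ (by omega)]
    unfold al
    split_ifs <;> exact hY.2.1 _
  · intro s hs
    rcases lt_trichotomy s r with h | h | h
    · rw [hatCh_le _ h.le, hatCh_le _ h]
      obtain ⟨b, e, hc⟩ := chain_cov hY (s := s) (by omega)
      obtain ⟨b', e', hc'⟩ := al_cov hd (chain_nb hY hr h hn) hc
      exact cov_to hc'
    · subst h
      rw [hatCh_le _ le_rfl, hatCh_gt _ (by omega)]
      exact cov_to (mid_cov hd (hY.1 s hr).1 hn)
    · rw [hatCh_gt _ h, hatCh_gt _ (by omega)]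
      obtain ⟨b, e, hc⟩ := chain_cov hY (s := s - 1) (by omega)
      have h1 : s - 1 + 1 = s := by omega
      rw [h1] at hc
      have h2 := hfix s (by omega) (by omega)
      have h3 := hfix (s - 1) (by omega) (by omega)
      obtain ⟨b', e', hc'⟩ := be_cov hd (by omega) hc
      exact cov_to hc'

/-- inverse of `al` -/
def ual (d : ℕ) (lam : ℕ → ℕ) (x : ℕ) : ℕ := if x ≤ d then lam x else lam (x + 1)

/-- inverse of `be` -/
def ube (d : ℕ) (lam : ℕ → ℕ) (x : ℕ) : ℕ := if x ≤ d then lam x - 1 else lam (x + 1)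

lemma ual_le {d x : ℕ} (lam : ℕ → ℕ) (h : x ≤ d) : ual d lam x = lam x := if_pos h
lemma ual_gt {d x : ℕ} (lam : ℕ → ℕ) (h : d < x) : ual d lam x = lam (x + 1) := if_neg (by omega)
lemma ual_ge {d x : ℕ} {lam : ℕ → ℕ} (he : lam d = lam (d + 1)) (h : d ≤ x) :
    ual d lam x = lam (x + 1) := by
  rcases eq_or_lt_of_le h with rfl | h
  · rw [ual_le _ le_rfl, he]
  · exact ual_gt _ h
lemma ube_le {d x : ℕ} (lam : ℕ → ℕ) (h : x ≤ d) : ube d lam x = lam x - 1 := if_pos h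
lemma ube_gt {d x : ℕ} (lam : ℕ → ℕ) (h : d < x) : ube d lam x = lam (x + 1) := if_neg (by omega)
lemma ube_ge {d x : ℕ} {lam : ℕ → ℕ} (he : lam d = lam (d + 1) + 1) (h : d ≤ x) :
    ube d lam x = lam (x + 1) := by
  rcases eq_or_lt_of_le h with rfl | h
  · rw [ube_le _ le_rfl, he]; rfl
  · exact ube_gt _ h

lemma al_ual {d : ℕ} {lam : ℕ → ℕ} (he : lam d = lam (d + 1)) : al d (ual d lam) = lam := by
  funext x
  by_cases hx : x ≤ d
  · rw [al_le _ hx, ual_le _ hx]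
  · rw [al_gt _ (by omega), ual_ge he (by omega), Nat.sub_add_cancel (by omega)]

lemma be_ube {d : ℕ} {lam : ℕ → ℕ} (hl : IsDiagram lam) (he : lam d = lam (d + 1) + 1) :
    be d (ube d lam) = lam := by
  funext x
  rcases Nat.eq_zero_or_pos x with h0 | h0
  · subst h0; simp [be, hl.1]
  by_cases hx : x ≤ d
  · rw [be_le _ h0 hx, ube_le _ hx]
    have := diag_anti hl h0 hx
    omega
  · rw [be_gt _ (by omega), ube_ge he (by omega), Nat.sub_add_cancel (by omega)]

lemma ual_diag {d : ℕ} {lam : ℕ → ℕ} (h : IsDiagram lam) : IsDiagram (ual d lam) := by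
  refine ⟨by rw [ual_le _ (by omega), h.1], ?_, ?_⟩
  · intro x hx
    by_cases h1 : x + 1 ≤ d
    · rw [ual_le _ h1, ual_le _ (by omega)]; exact h.2.1 x hx
    · rw [ual_gt _ (by omega)]
      unfold ual
      split_ifs <;> exact diag_anti h (by omega) (by omega)
  · obtain ⟨N, hN⟩ := h.2.2
    refine ⟨N + d + 1, fun x hx => ?_⟩
    rw [ual_gt _ (by omega)]; exact hN _ (by omega)

lemma ube_diag {d : ℕ} {lam : ℕ → ℕ} (h : IsDiagram lam) (hd : 1 ≤ d)
    (he : lam d = lam (d + 1) + 1) : IsDiagram (ube d lam) := by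
  refine ⟨by rw [ube_le _ (by omega), h.1], ?_, ?_⟩
  · intro x hx
    by_cases h1 : x + 1 ≤ d
    · rw [ube_le _ h1, ube_le _ (by omega)]; have := h.2.1 x hx; omega
    · rw [ube_ge he (by omega), ube_ge he (by omega)]
      exact diag_anti h (by omega) (by omega)
  · obtain ⟨N, hN⟩ := h.2.2
    refine ⟨N + d + 1, fun x hx => ?_⟩
    rw [ube_gt _ (by omega)]; exact hN _ (by omega)

/-- equal rows `d`, `d + 1` are both or neither met by a strip -/
lemma Cov.pair {d : ℕ} {mu lam : ℕ → ℕ} {b e : ℕ} (h : Cov mu lam b e)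
    (he : lam d = lam (d + 1)) (hd : 1 ≤ d) : (b ≤ d ∧ d + 1 ≤ e) ∨ (e < d ∨ d + 1 < b) := by
  obtain ⟨hb, hbe, hc, ht, hm, hi, ho⟩ := h
  have h1 : e ≠ d := by rintro rfl; omega
  have h2 : b ≠ d + 1 := by
    rintro rfl
    simp only [Nat.add_sub_cancel] at ht
    rcases eq_or_lt_of_le hbe with h3 | h3
    · subst h3; omega
    · have := hm (d + 1) le_rfl h3
      omega
  omega

lemma Cov.pair_eq {d : ℕ} {mu lam : ℕ → ℕ} {b e : ℕ} (h : Cov mu lam b e)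
    (he : lam d = lam (d + 1)) (hd : 1 ≤ d) : mu d = mu (d + 1) := by
  rcases h.pair he hd with h1 | h1
  · have := h.eqIn d h1.1 (by omega)
    have := h.eqIn (d + 1) (by omega) h1.2
    omega
  · have := h.eqOut d (by omega)
    have := h.eqOut (d + 1) (by omega)
    omega

lemma ual_cov {d : ℕ} {mu lam : ℕ → ℕ} {b e : ℕ} (hd : 1 ≤ d) (hn : NB lam d)
    (he : lam d = lam (d + 1)) (h : Cov mu lam b e) :
    ∃ b' e', Cov (ual d mu) (ual d lam) b' e' := by
  have he' := h.pair_eq he hd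
  have hp := h.pair he hd
  obtain ⟨hb, hbe, hc, ht, hm, hi, ho⟩ := id h
  by_cases hed : e < d
  · refine ⟨b, e, hb, hbe, ?_, ?_, ?_, ?_, ?_⟩
    · rwa [ual_le _ (by omega), ual_le _ (by omega)]
    · rwa [ual_le _ (by omega), ual_le _ (by omega)]
    · intro x h1 h2
      rw [ual_le _ (by omega), ual_le _ (by omega)]; exact hm x h1 h2
    · intro x h1 h2
      rw [ual_le _ (by omega), ual_le _ (by omega)]; exact hi x h1 h2
    · intro x h1
      by_cases hx : x ≤ d
      · rw [ual_le _ hx, ual_le _ hx]; exact ho x h1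
      · rw [ual_gt _ (by omega), ual_gt _ (by omega)]; exact ho _ (by omega)
  · obtain ⟨e, rfl⟩ : ∃ e', e = e' + 1 := ⟨e - 1, by omega⟩
    by_cases hbd : b ≤ d
    · have hb1 := h.start_one hn hbd (by omega)
      subst hb1
      refine ⟨1, e, le_rfl, by omega, ?_, Or.inl rfl, ?_, ?_, ?_⟩
      · rw [ual_ge he (by omega), ual_ge he (by omega)]; exact hc
      · intro x h1 h2
        rw [ual_ge (x := e) he (by omega)]
        by_cases hx : x < d
        · rw [ual_le _ (by omega)]
          have := hn x h1 hx
          have := hm d (by omega) (by omega)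
          have : lam (d + 1) + (d + 1) ≤ lam (e + 1) + (e + 1) := by
            rcases eq_or_lt_of_le (show d ≤ e by omega) with rfl | h3
            · omega
            · have := hm (d + 1) (by omega) (by omega); omega
          omega
        · rw [ual_ge he (by omega)]
          have := hm (x + 1) (by omega) (by omega); omega
      · intro x h1 h2
        by_cases hx : x ≤ d
        · rw [ual_le _ hx, ual_le _ hx]; exact hi x h1 (by omega)
        · rw [ual_gt _ (by omega), ual_gt _ (by omega)]; exact hi _ (by omega) (by omega)
      · intro x h1
        by_cases hx : x ≤ d
        · rw [ual_le _ hx, ual_le _ hx]; exact ho x (by omega)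
        · rw [ual_gt _ (by omega), ual_gt _ (by omega)]; exact ho _ (by omega)
    · obtain ⟨b, rfl⟩ : ∃ b', b = b' + 1 := ⟨b - 1, by omega⟩
      refine ⟨b, e, by omega, by omega, ?_, ?_, ?_, ?_, ?_⟩
      · rw [ual_ge he (by omega), ual_ge he (by omega)]; exact hc
      · rw [ual_ge he (by omega), ual_ge he (by omega), Nat.sub_add_cancel (by omega)]
        simp only [Nat.add_sub_cancel] at ht; omega
      · intro x h1 h2
        rw [ual_ge he (by omega), ual_ge he (by omega)]
        have := hm (x + 1) (by omega) (by omega); omega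
      · intro x h1 h2
        rw [ual_ge he (by omega), ual_ge he' (by omega)]; exact hi _ (by omega) (by omega)
      · intro x h1
        by_cases hx : x ≤ d
        · rw [ual_le _ hx, ual_le _ hx]; exact ho x (by omega)
        · rw [ual_gt _ (by omega), ual_gt _ (by omega)]; exact ho _ (by omega)

lemma ube_cov {d : ℕ} {mu lam : ℕ → ℕ} {b e : ℕ} (hd : 1 ≤ d) (hl : IsDiagram lam)
    (hmu : IsDiagram mu)
    (he : lam d = lam (d + 1) + 1) (hf : lam d = mu d) (hf' : lam (d + 1) = mu (d + 1))
    (h : Cov mu lam b e) :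
    ∃ b' e', Cov (ube d mu) (ube d lam) b' e' := by
  have he' : mu d = mu (d + 1) + 1 := by omega
  obtain ⟨hb, hbe, hc, ht, hm, hi, ho⟩ := id h
  have hnot : ¬ (b ≤ d ∧ d ≤ e) := fun hh => by
    have := hi d hh.1 hh.2; omega
  have hnot' : ¬ (b ≤ d + 1 ∧ d + 1 ≤ e) := fun hh => by
    have := hi (d + 1) hh.1 hh.2; omega
  have hpos : ∀ x, 1 ≤ x → x ≤ d → 1 ≤ lam x := fun x h1 h2 => by
    have := diag_anti hl h1 h2; omega
  have hpos' : ∀ x, 1 ≤ x → x ≤ d → 1 ≤ mu x := fun x h1 h2 => by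
    have := diag_anti hmu h1 h2; omega
  by_cases hed : e < d
  · refine ⟨b, e, hb, hbe, ?_, ?_, ?_, ?_, ?_⟩
    · rw [ube_le _ (by omega), ube_le _ (by omega)]
      have := hpos (e + 1) (by omega) (by omega)
      omega
    · rcases eq_or_ne b 1 with h1 | h1
      · exact Or.inl h1
      · rw [ube_le _ (by omega), ube_le _ (by omega)]
        have := hpos e (by omega) (by omega)
        omega
    · intro x h1 h2
      rw [ube_le _ (by omega), ube_le _ (by omega)]
      have := hm x h1 h2
      have := hpos x (by omega) (by omega)
      have := hpos e (by omega) (by omega)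
      omega
    · intro x h1 h2
      rw [ube_le _ (by omega), ube_le _ (by omega)]
      have := hi x h1 h2
      have := hpos' x (by omega) (by omega)
      omega
    · intro x h1
      by_cases hx : x ≤ d
      · rw [ube_le _ hx, ube_le _ hx, ho x h1]
      · rw [ube_gt _ (by omega), ube_gt _ (by omega)]; exact ho _ (by omega)
  · obtain ⟨e, rfl⟩ : ∃ e', e = e' + 1 := ⟨e - 1, by omega⟩
    obtain ⟨b, rfl⟩ : ∃ b', b = b' + 1 := ⟨b - 1, by omega⟩
    refine ⟨b, e, by omega, by omega, ?_, ?_, ?_, ?_, ?_⟩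
    · rw [ube_ge he (by omega), ube_ge he (by omega)]; exact hc
    · rw [ube_ge he (by omega), ube_ge he (by omega), Nat.sub_add_cancel (by omega)]
      simp only [Nat.add_sub_cancel] at ht; omega
    · intro x h1 h2
      rw [ube_ge he (by omega), ube_ge he (by omega)]
      have := hm (x + 1) (by omega) (by omega); omega
    · intro x h1 h2
      rw [ube_ge he (by omega), ube_ge he' (by omega)]; exact hi _ (by omega) (by omega)
    · intro x h1
      by_cases hx : x ≤ d
      · rw [ube_le _ hx, ube_le _ hx, ho x (by omega)]
      · rw [ube_gt _ (by omega), ube_gt _ (by omega)]; exact ho _ (by omega)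

/-- inverse of `hatCh` -/
def unhat (d r : ℕ) (Z : ℕ → ℕ → ℕ) (s : ℕ) : ℕ → ℕ :=
  if s ≤ r then ual d (Z s) else ube d (Z (s + 1))

lemma unhat_le {d r s : ℕ} (Y : ℕ → ℕ → ℕ) (h : s ≤ r) : unhat d r Y s = ual d (Y s) := if_pos h

lemma unhat_main {Z : ℕ → ℕ → ℕ} {l d r : ℕ} (hZ : IsTamariChain Z (l + 1)) (hr : r ≤ l)
    (hd : 1 ≤ d) (hc : Cov (Z r) (Z (r + 1)) 1 d) (he : Z r d = Z r (d + 1))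
    (hfix : ∀ s, r + 1 ≤ s → s ≤ l + 1 → Z s d = Z (r + 1) d)
    (hfix' : ∀ s, r + 1 ≤ s → s ≤ l + 1 → Z s (d + 1) = Z (r + 1) (d + 1)) :
    IsTamariChain (unhat d r Z) l ∧ (∀ s, s ≤ l + 1 → hatCh d r (unhat d r Z) s = Z s) ∧
      (∀ s, r ≤ s → unhat d r Z s = ube d (Z (s + 1))) := by
  have hnb : NB (Z (r + 1)) d := hc.mid
  have hnb' : ∀ s, s ≤ r + 1 → NB (Z s) d := fun s hs => chain_nb hZ (by omega) hs hnb
  have heq : ∀ k s, s + k = r → Z s d = Z s (d + 1) := by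
    intro k
    induction k with
    | zero => intro s hs; rw [show s = r by omega]; exact he
    | succ k ih =>
      intro s hs
      obtain ⟨b, e, h⟩ := chain_cov hZ (s := s) (by omega)
      exact h.pair_eq (ih (s + 1) (by omega)) hd
  have heq : ∀ s, s ≤ r → Z s d = Z s (d + 1) := fun s hs => heq (r - s) s (by omega)
  have h1 := hc.eqIn d hd le_rfl
  have h2 := hc.eqOut (d + 1) (by omega)
  have heq' : ∀ s, r + 1 ≤ s → s ≤ l + 1 → Z s d = Z s (d + 1) + 1 := by
    intro s h3 h4
    rw [hfix s h3 h4, hfix' s h3 h4]; omega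
  have hge : ∀ s, r ≤ s → unhat d r Z s = ube d (Z (s + 1)) := by
    intro s hs
    unfold unhat
    split_ifs with h
    · have : s = r := by omega
      subst this
      funext x
      by_cases hx : x ≤ d
      · rw [ual_le _ hx, ube_le _ hx]
        rcases Nat.eq_zero_or_pos x with h0 | h0
        · subst h0
          rw [(hZ.1 s (by omega)).1, (hZ.1 (s + 1) (by omega)).1]
        · have := hc.eqIn x h0 hx; omega
      · rw [ual_gt _ (by omega), ube_gt _ (by omega)]
        exact (hc.eqOut _ (by omega)).symm
    · rfl
  refine ⟨⟨?_, ?_, ?_⟩, ?_, hge⟩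
  · intro s hs
    by_cases h : s ≤ r
    · rw [unhat_le _ h]; exact ual_diag (hZ.1 s (by omega))
    · rw [hge s (by omega)]
      exact ube_diag (hZ.1 _ (by omega)) hd (heq' _ (by omega) (by omega))
  · intro x
    rw [unhat_le _ (by omega)]
    unfold ual
    split_ifs <;> exact hZ.2.1 _
  · intro s hs
    by_cases h : s < r
    · rw [unhat_le _ h.le, unhat_le _ h]
      obtain ⟨b, e, hcv⟩ := chain_cov hZ (s := s) (by omega)
      obtain ⟨b', e', hc'⟩ := ual_cov hd (hnb' _ (by omega)) (heq _ h) hcv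
      exact cov_to hc'
    · rw [hge s (by omega), hge (s + 1) (by omega)]
      obtain ⟨b, e, hcv⟩ := chain_cov hZ (s := s + 1) (by omega)
      have a1 := hfix (s + 1) (by omega) (by omega)
      have a2 := hfix (s + 1 + 1) (by omega) (by omega)
      have a3 := hfix' (s + 1) (by omega) (by omega)
      have a4 := hfix' (s + 1 + 1) (by omega) (by omega)
      obtain ⟨b', e', hc'⟩ := ube_cov hd (hZ.1 _ (by omega)) (hZ.1 _ (by omega))
        (heq' _ (by omega) (by omega)) (by omega) (by omega) hcv
      exact cov_to hc'
  · intro s hs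
    by_cases h : s ≤ r
    · rw [hatCh_le _ h, unhat_le _ h, al_ual (heq s h)]
    · rw [hatCh_gt _ (by omega), hge _ (by omega), Nat.sub_add_cancel (by omega)]
      exact be_ube (hZ.1 _ hs) (heq' _ (by omega) hs)

/-- Data attached to `hatD`. -/
structure HD (Y : ℕ → ℕ → ℕ) (n r d : ℕ) : Prop where
  h1 : 1 ≤ d
  h2 : d ≤ n
  full : Y r d = n - d
  lt : ∀ x, 1 ≤ x → x < d → Y r x < n - x

lemma hatD_spec {Y : ℕ → ℕ → ℕ} {l n r : ℕ} (hY : IsTamariChain Y l) (hr : r ≤ l) (hn : 1 ≤ n)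
    (hl : ∀ x, Y l x = dstair n x) : HD Y n r (hatD (psiFun Y l) n r) := by
  set S := ({k | 1 ≤ k ∧ k ≤ n - 1 ∧ 1 ≤ psiFun Y l (k, n - k) ∧ psiFun Y l (k, n - k) ≤ r} ∪ {n}
    : Set ℕ) with hS
  have hd : hatD (psiFun Y l) n r = sInf S := rfl
  rw [hd]
  have hnS : n ∈ S := Or.inr rfl
  have hmem := Nat.sInf_mem ⟨n, hnS⟩
  have hle := Nat.sInf_le hnS
  have hlow : ∀ x, x < sInf S → x ∉ S := fun x hx => Nat.notMem_of_lt_sInf hx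
  have hub : ∀ x, 1 ≤ x → Y r x ≤ n - x := fun x hx => by
    have := chain_mono hY hr le_rfl x
    rw [hl, dstair, if_neg (by omega)] at this; exact this
  generalize sInf S = d at *
  have hd1 : 1 ≤ d := by
    rcases hmem with h | h
    · exact h.1
    · have : d = n := h
      omega
  refine ⟨hd1, hle, ?_, ?_⟩
  · have := hub d hd1
    rcases hmem with h | h
    · have := (psi_le hY hr hd1).1 ⟨by have := h.2.2.1; omega, h.2.2.2⟩
      omega
    · have : d = n := h
      omega
  · intro x hx hxd
    by_contra hc
    apply hlow x hxd
    left
    have := (psi_le hY (y := n - x) hr hx).2 ⟨by omega, by omega⟩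
    exact ⟨hx, by omega, by omega, this.2⟩

lemma HD.unique {Y : ℕ → ℕ → ℕ} {n r d d' : ℕ} (h : HD Y n r d) (h' : HD Y n r d') : d = d' := by
  rcases lt_trichotomy d d' with h1 | h1 | h1
  · have := h'.lt d h.h1 h1
    have := h.full
    omega
  · exact h1
  · have := h.lt d' h'.h1 h1
    have := h'.full
    omega

lemma HD.nb {Y : ℕ → ℕ → ℕ} {n r d : ℕ} (h : HD Y n r d) : NB (Y r) d := by
  intro x h1 h2
  have := h.lt x h1 h2
  have := h.full
  have := h.h2
  omega

lemma HD.fix {Y : ℕ → ℕ → ℕ} {l n r d : ℕ} (h : HD Y n r d) (hY : IsTamariChain Y l)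
    (hl : ∀ x, Y l x = dstair n x) (s : ℕ) (h1 : r ≤ s) (h2 : s ≤ l) : Y s d = Y r d := by
  have a := chain_mono hY h1 h2 d
  have b := chain_mono hY h2 le_rfl d
  have c := h.full
  have := h.h1
  rw [hl, dstair, if_neg (by omega)] at b
  omega

lemma HD.chain {Y : ℕ → ℕ → ℕ} {l n r d : ℕ} (h : HD Y n r d) (hY : IsTamariChain Y l)
    (hr : r ≤ l) (hl : ∀ x, Y l x = dstair n x) : IsTamariChain (hatCh d r Y) (l + 1) :=
  hat_chain hY hr h.h1 h.nb (h.fix hY hl)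

lemma psi_ext {Z : ℕ → ℕ → ℕ} {l : ℕ} (hZ : IsTamariChain Z l) {x y v : ℕ} (hx : 1 ≤ x)
    (h0 : v = 0 → y = 0 ∨ Z l x < y)
    (h1 : ∀ w, v = w + 1 → w < l ∧ Z w x < y ∧ y ≤ Z (w + 1) x) : v = psiFun Z l (x, y) := by
  rcases v with _ | w
  · rw [psi_zero]
    have := h0 rfl
    omega
  · have := h1 w rfl
    exact ((psi_eq hZ this.1 hx).2 this.2).symm

lemma hatFun_eq {Y : ℕ → ℕ → ℕ} {l n r : ℕ} (hY : IsTamariChain Y l) (hr : r ≤ l) (hn : 1 ≤ n)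
    (hl : ∀ x, Y l x = dstair n x) :
    hatFun (psiFun Y l) n r = psiFun (hatCh (hatD (psiFun Y l) n r) r Y) (l + 1) := by
  have hD := hatD_spec hY hr hn hl
  set d := hatD (psiFun Y l) n r with hd
  have hC := hD.chain hY hr hl
  have hd1 := hD.h1
  funext ⟨x, y⟩
  unfold hatFun
  simp only [← hd]
  by_cases h0 : x = 0 ∨ y = 0
  · rw [if_pos h0, psi_zero (by omega)]
  rw [if_neg h0]
  have hx : 1 ≤ x := by omega
  have hy : 1 ≤ y := by omega
  have hZl : hatCh d r Y (l + 1) = be d (Y l) := by rw [hatCh_gt _ (by omega)]; rfl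
  by_cases hxd : x ≤ d
  · rw [if_pos hxd]
    have a1 := psi_le hY (x := x) (y := y) hr hx
    split_ifs with h1 h2 h3
    · apply psi_ext hC hx (fun h => absurd h h1.1)
      intro w hw
      have := (psi_eq hY (by omega) hx).1 hw
      rw [hatCh_le _ (by omega), hatCh_le _ (by omega), al_le _ hxd, al_le _ hxd]
      omega
    · rw [psi_lowLen hY hr hx] at h2
      apply psi_ext hC hx (by omega)
      intro w hw
      rw [hatCh_le _ (by omega), hatCh_gt _ (by omega), al_le _ hxd, be_le _ hx hxd]
      have : w = r := by omega
      subst this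
      simp only [Nat.add_sub_cancel]
      omega
    · apply psi_ext hC hx (by omega)
      intro w hw
      have hw : psiFun Y l (x, y - 1) = w := by omega
      obtain ⟨w, rfl⟩ : ∃ u, w = u + 1 := ⟨w - 1, by omega⟩
      have h5 : w < l := by
        have := psi_spec hY ((psi_ne hY (x := x) (y := y - 1)).1 (by omega))
        omega
      have := (psi_eq hY h5 hx).1 hw
      rw [hatCh_gt _ (by omega), hatCh_gt _ (by omega), be_le _ hx hxd, be_le _ hx hxd]
      simp only [Nat.add_sub_cancel]
      omega
    · apply psi_ext hC hx _ (by omega)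
      intro _
      right
      rw [hZl, be_le _ hx hxd]
      rw [psi_lowLen hY hr hx] at h2
      have a2 := psi_le hY (x := x) (y := y - 1) hr hx
      have a3 := psi_ne hY (x := x) (y := y - 1)
      omega
  · rw [if_neg hxd]
    have hgen : ∀ w, w < l → psiFun Y l (x - 1, y) = w + 1 →
        Y w (x - 1) < y ∧ y ≤ Y (w + 1) (x - 1) := fun w h1 h2 =>
      (psi_eq hY h1 (by omega)).1 h2
    have hbd : psiFun Y l (x - 1, y) ≤ l := by
      by_cases h : psiFun Y l (x - 1, y) = 0
      · omega
      · exact (psi_spec hY ((psi_ne hY).1 h)).2.1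
    have hz : psiFun Y l (x - 1, y) = 0 → Y l (x - 1) < y := by
      intro h
      have := psi_ne hY (x := x - 1) (y := y)
      omega
    have hsmall : psiFun Y l (x - 1, y) ≤ r →
        psiFun Y l (x - 1, y) = psiFun (hatCh d r Y) (l + 1) (x, y) := by
      intro hsm
      apply psi_ext hC hx
      · intro h
        rw [hZl, be_gt _ (by omega)]
        exact Or.inr (hz h)
      · intro w hw
        rw [hatCh_le _ (by omega), hatCh_le _ (by omega), al_gt _ (by omega), al_gt _ (by omega)]
        have := hgen w (by omega) hw
        omega
    split_ifs with h1 h2 h3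
    · have hxx : x - 1 = d := by omega
      rw [hxx] at hsmall
      apply hsmall
      by_cases h : psiFun Y l (d, y) = 0
      · omega
      · have b1 := (psi_ne hY).1 h
        rw [hD.fix hY hl l hr le_rfl] at b1
        exact ((psi_le hY hr hd1).2 b1.2).2
    · rw [← hsmall (by omega), h2]
    · exact hsmall h3
    · apply psi_ext hC hx (by omega)
      intro w hw
      obtain ⟨w, rfl⟩ : ∃ u, w = u + 1 := ⟨w - 1, by omega⟩
      have := hgen w (by omega) (by omega)
      rw [hatCh_gt _ (by omega), hatCh_gt _ (by omega), be_gt _ (by omega), be_gt _ (by omega)]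
      simp only [Nat.add_sub_cancel]
      omega

lemma psi_inj {Y Z : ℕ → ℕ → ℕ} {l : ℕ} (hY : IsTamariChain Y l) (hZ : IsTamariChain Z l)
    (h : psiFun Y l = psiFun Z l) {s x : ℕ} (hs : s ≤ l) : Y s x = Z s x := by
  rcases Nat.eq_zero_or_pos x with h0 | h0
  · subst h0
    rw [(hY.1 s hs).1, (hZ.1 s hs).1]
  · rw [← psi_lowLen hY hs h0, h, psi_lowLen hZ hs h0]

lemma psi_congr {Y Z : ℕ → ℕ → ℕ} {l : ℕ} (h : ∀ s, s ≤ l → Y s = Z s) :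
    psiFun Y l = psiFun Z l := by
  funext ⟨x, y⟩
  unfold psiFun
  rw [h l le_rfl]
  have : {r | r ≤ l ∧ y ≤ Y r x} = {r | r ≤ l ∧ y ≤ Z r x} := by
    ext t
    constructor
    · rintro ⟨h1, h2⟩; exact ⟨h1, by rwa [← h t h1]⟩
    · rintro ⟨h1, h2⟩; exact ⟨h1, by rwa [h t h1]⟩
  simp only [this]

lemma hatCh_d_le {Y Y' : ℕ → ℕ → ℕ} {r d d' : ℕ} (hd : 1 ≤ d)
    (h1 : hatCh d r Y r d = hatCh d' r Y' r d)
    (h2 : hatCh d r Y (r + 1) d = hatCh d' r Y' (r + 1) d) : d ≤ d' := by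
  by_contra hc
  rw [hatCh_le _ le_rfl, hatCh_le _ le_rfl, al_le _ le_rfl, al_gt _ (by omega)] at h1
  rw [hatCh_gt _ (by omega), hatCh_gt _ (by omega), be_le _ hd le_rfl, be_gt _ (by omega)] at h2
  simp only [Nat.add_sub_cancel] at h2
  omega

lemma hatCh_inj {Y Y' : ℕ → ℕ → ℕ} {r d l : ℕ}
    (hY : IsTamariChain Y l) (hY' : IsTamariChain Y' l)
    (h : ∀ s x, s ≤ l + 1 → hatCh d r Y s x = hatCh d r Y' s x) (s : ℕ) (hs : s ≤ l) :
    Y s = Y' s := by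
  funext x
  rcases Nat.eq_zero_or_pos x with h0 | h0
  · subst h0
    rw [(hY.1 s hs).1, (hY'.1 s hs).1]
  by_cases hsr : s ≤ r
  · by_cases hx : x ≤ d
    · have := h s x (by omega)
      rwa [hatCh_le _ hsr, hatCh_le _ hsr, al_le _ hx, al_le _ hx] at this
    · have := h s (x + 1) (by omega)
      rwa [hatCh_le _ hsr, hatCh_le _ hsr, al_gt _ (by omega), al_gt _ (by omega)] at this
  · by_cases hx : x ≤ d
    · have := h (s + 1) x (by omega)
      rw [hatCh_gt _ (by omega), hatCh_gt _ (by omega), be_le _ h0 hx, be_le _ h0 hx] at this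
      simp only [Nat.add_sub_cancel] at this
      omega
    · have := h (s + 1) (x + 1) (by omega)
      rwa [hatCh_gt _ (by omega), hatCh_gt _ (by omega), be_gt _ (by omega),
        be_gt _ (by omega)] at this

/-- **Theorem 4.6.**  For `i ≥ -1`, `n ≥ 1` and `0 ≤ r ≤ n + i`, the map `C ↦ Ĉ(r)` is a
bijection from `C_i(n)` to the set of `C̃ ∈ C_i(n+1)` having an `(r+1)⁺`-full-set. -/
theorem hat_bijection (i : ℤ) (hi : -1 ≤ i) (n : ℕ) (hn : 1 ≤ n) (r : ℕ)
    (hr : (r : ℤ) ≤ (n : ℤ) + i) :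
    Set.BijOn (fun C => hatFun C n r)
      {C : ℕ × ℕ → ℕ | MemC i n C}
      {C : ℕ × ℕ → ℕ | MemC i (n + 1) C ∧ HasPlusFullSet C (n + 1) (r + 1)} := by
  refine ⟨?_, ?_, ?_⟩
  · intro f hf
    obtain ⟨l, Y, hY, rfl, hl, hli⟩ := memC_iff.1 hf
    have hrl : r ≤ l := by omega
    have hD := hatD_spec hY hrl hn hl
    show MemC i (n + 1) (hatFun _ n r) ∧ HasPlusFullSet (hatFun _ n r) (n + 1) (r + 1)
    rw [hatFun_eq hY hrl hn hl]
    set d := hatD (psiFun Y l) n r with hd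
    have hC := hD.chain hY hrl hl
    have hd1 := hD.h1
    have hd2 := hD.h2
    have hfull := hD.full
    refine ⟨memC_iff.2 ⟨l + 1, _, hC, rfl, ?_, by push_cast; omega⟩, d, ⟨?_, hd1, by omega, ?_, ?_⟩,
      ?_⟩
    · intro x
      rw [hatCh_gt _ (by omega)]
      simp only [Nat.add_sub_cancel]
      rcases Nat.eq_zero_or_pos x with h0 | h0
      · subst h0; simp [be, dstair]
      · by_cases hx : x ≤ d
        · rw [be_le _ h0 hx, hl, dstair, dstair, if_neg (by omega), if_neg (by omega)]; omega
        · rw [be_gt _ (by omega), hl, dstair, dstair, if_neg (by omega), if_neg (by omega)]; omega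
    · refine ⟨Y r 1 + 1, (psi_eq hC (by omega) le_rfl).2 ?_⟩
      rw [hatCh_le _ le_rfl, hatCh_gt _ (by omega), al_le _ hd1, be_le _ le_rfl hd1]
      simp
    · rw [psi_eq hC (by omega) hd1, hatCh_le _ le_rfl, hatCh_gt _ (by omega), al_le _ le_rfl,
        be_le _ hd1 le_rfl]
      simp only [Nat.add_sub_cancel]
      omega
    · intro x y hxy
      by_contra hx
      rw [psi_eq hC (by omega) (by omega), hatCh_le _ le_rfl, hatCh_gt _ (by omega),
        al_gt _ (by omega), be_gt _ (by omega)] at hxy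
      simp only [Nat.add_sub_cancel] at hxy
      omega
    · by_cases hdn : d = n
      · left; omega
      · right
        refine ⟨by omega, ?_⟩
        have := (psi_le hC (x := d + 1) (y := n + 1 - d - 1) (s := r) (by omega) (by omega)).2 ?_
        · omega
        · rw [hatCh_le _ le_rfl, al_gt _ (by omega)]
          simp only [Nat.add_sub_cancel]
          omega
  · intro f hf f' hf' heq
    obtain ⟨l, Y, hY, rfl, hl, hli⟩ := memC_iff.1 hf
    obtain ⟨l', Y', hY', rfl, hl', hli'⟩ := memC_iff.1 hf'
    have : l' = l := by omega
    subst this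
    have hrl : r ≤ l' := by omega
    have hD := hatD_spec hY hrl hn hl
    have hD' := hatD_spec hY' hrl hn hl'
    change hatFun _ n r = hatFun _ n r at heq
    rw [hatFun_eq hY hrl hn hl, hatFun_eq hY' hrl hn hl'] at heq
    generalize hatD (psiFun Y l') n r = d at *
    generalize hatD (psiFun Y' l') n r = d' at *
    have key : ∀ s x, s ≤ l' + 1 → hatCh d r Y s x = hatCh d' r Y' s x := fun s x hs =>
      psi_inj (hD.chain hY hrl hl) (hD'.chain hY' hrl hl') heq hs
    have e1 := hatCh_d_le hD.h1 (key r d (by omega)) (key (r + 1) d (by omega))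
    have e2 := hatCh_d_le hD'.h1 (key r d' (by omega)).symm (key (r + 1) d' (by omega)).symm
    have : d = d' := by omega
    subst this
    exact psi_congr (hatCh_inj hY hY' key)
  · rintro g ⟨hg, k, ⟨⟨y1, hy1⟩, hk1, hk2, hk3, hk4⟩, hplus⟩
    obtain ⟨L, Z, hZ, rfl, hl, hli⟩ := memC_iff.1 hg
    obtain ⟨l, rfl⟩ : ∃ l, L = l + 1 := ⟨L - 1, by push_cast at hli; omega⟩
    have hrl : r ≤ l := by push_cast at hli; omega
    have hub : ∀ s x, s ≤ l + 1 → 1 ≤ x → Z s x ≤ n + 1 - x := fun s x hs hx => by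
      have := chain_mono hZ hs le_rfl x
      rw [hl, dstair, if_neg (by omega)] at this; exact this
    rw [psi_eq hZ (by omega) le_rfl] at hy1
    rw [psi_eq hZ (by omega) hk1] at hk3
    obtain ⟨b, e, hc⟩ := chain_cov hZ (s := r) (by omega)
    have hb1 := hc.hb
    have hb2 := hc.hbe
    have hbe1 : b = 1 := by
      by_contra h
      have := hc.eqOut 1 (by omega); omega
    have hek : e = k := by
      apply le_antisymm
      · apply hk4 e (Z (r + 1) e)
        rw [psi_eq hZ (by omega) (by omega)]
        have := hc.eqIn e hb2 le_rfl
        omega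
      · by_contra h
        have := hc.eqOut k (by omega); omega
    subst hbe1 hek
    have hZe : Z (r + 1) e = n + 1 - e := by
      have := hub (r + 1) e (by omega) hk1; omega
    have h1 := hc.eqIn e hk1 le_rfl
    have h2 := hc.eqOut (e + 1) (by omega)
    have hZe' : Z r (e + 1) = n - e := by
      have h3 := hub r (e + 1) (by omega) (by omega)
      rcases hplus with h | ⟨h, h'⟩
      · omega
      · by_cases hen : e = n
        · omega
        have h4 : psiFun Z (l + 1) (e + 1, n + 1 - e - 1) ≠ 0 := by
          rw [psi_ne hZ, hl, dstair, if_neg (by omega)]; omega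
        have := (psi_le hZ (s := r) (by omega) (by omega)).1 ⟨h4, by omega⟩
        omega
    obtain ⟨hU, hhat, hge⟩ := unhat_main (l := l) hZ hrl hk1 hc (by omega)
      (fun s hs1 hs2 => by
        have := hub s e hs2 hk1
        have := chain_mono hZ hs1 hs2 e
        omega)
      (fun s hs1 hs2 => by
        have := hub s (e + 1) hs2 (by omega)
        have := chain_mono hZ hs1 hs2 (e + 1)
        omega)
    have hUl : ∀ x, unhat e r Z l x = dstair n x := by
      intro x
      rw [hge l hrl]
      rcases Nat.eq_zero_or_pos x with h0 | h0
      · subst h0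
        rw [ube_le _ (by omega), hl]; simp [dstair]
      · by_cases hx : x ≤ e
        · rw [ube_le _ hx, hl, dstair, dstair, if_neg (by omega), if_neg (by omega)]; omega
        · rw [ube_gt _ (by omega), hl, dstair, dstair, if_neg (by omega), if_neg (by omega)]; omega
    have hD : HD (unhat e r Z) n r e := by
      refine ⟨hk1, by omega, ?_, ?_⟩
      · rw [unhat_le _ le_rfl, ual_le _ le_rfl]; omega
      · intro x hx1 hx2
        rw [unhat_le _ le_rfl, ual_le _ (by omega)]
        have := hc.mid x hx1 hx2
        have := hc.eqIn x hx1 (by omega)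
        omega
    refine ⟨psiFun (unhat e r Z) l, memC_iff.2 ⟨l, _, hU, rfl, hUl, by push_cast at hli; omega⟩, ?_⟩
    show hatFun _ n r = _
    rw [hatFun_eq hU hrl hn hUl, ← hD.unique (hatD_spec hU hrl hn hUl)]
    exact psi_congr hhat

end TamariMaxChains
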